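/- Let (M,d) be a complete cone metric space over a real Banach space E with cone P, where P is normal with normal constant K. Let S and T be self-maps of M such that (a) T is sequentially continuous, (b) S(M) ⊆ T(M), (c) S and T commute, and (d) the generalized Kannan contraction condition d(Sx,Sy) ≤ b·[d(Sx,Tx) + d(Sy,Ty)] holds for all x, y ∈ M, where 0 ≤ b < 1/2. Then S and T have a unique common fixed point. -/

import Mathlib

/-- `P` is a cone in the real Banach space `E`. -/
def IsCone {E : Type*} [NormedAddCommGroup E] [NormedSpace ℝ E] (P : Set E) : Prop :=
  IsClosed P ∧ P.Nonempty ∧ P ≠ {0} ∧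
    (∀ a b : ℝ, 0 ≤ a → 0 ≤ b → ∀ x ∈ P, ∀ y ∈ P, a • x + b • y ∈ P) ∧
    P ∩ (-P) = {0}

/-- The partial order induced by the cone `P`: `x ≤ y` iff `y - x ∈ P`. -/
def ConeLe {E : Type*} [NormedAddCommGroup E] [NormedSpace ℝ E] (P : Set E) (x y : E) : Prop :=
  y - x ∈ P

/-- `x ≪ y` iff `y - x ∈ interior P`. -/
def ConeLt {E : Type*} [NormedAddCommGroup E] [NormedSpace ℝ E] (P : Set E) (x y : E) : Prop :=
  y - x ∈ interior P

/-- `P` is a normal cone with normal constant `K`. -/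
def IsNormalCone {E : Type*} [NormedAddCommGroup E] [NormedSpace ℝ E] (P : Set E) (K : ℝ) : Prop :=
  0 < K ∧ ∀ x y : E, ConeLe P 0 x → ConeLe P x y → ‖x‖ ≤ K * ‖y‖

/-- `d` is a cone metric on `M` with respect to the cone `P`. -/
def IsConeMetric {E M : Type*} [NormedAddCommGroup E] [NormedSpace ℝ E]
    (P : Set E) (d : M → M → E) : Prop :=
  (∀ x y : M, ConeLe P 0 (d x y)) ∧
  (∀ x y : M, d x y = 0 ↔ x = y) ∧
  (∀ x y : M, d x y = d y x) ∧
  (∀ x y z : M, ConeLe P (d x y) (d x z + d z y))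

/-- Convergence of a sequence in a cone metric space. -/
def ConeConv {E M : Type*} [NormedAddCommGroup E] [NormedSpace ℝ E]
    (P : Set E) (d : M → M → E) (u : ℕ → M) (x : M) : Prop :=
  ∀ c : E, ConeLt P 0 c → ∃ n₀ : ℕ, ∀ n ≥ n₀, ConeLt P (d (u n) x) c

/-- Cauchy sequences in a cone metric space. -/
def ConeCauchy {E M : Type*} [NormedAddCommGroup E] [NormedSpace ℝ E]
    (P : Set E) (d : M → M → E) (u : ℕ → M) : Prop :=
  ∀ c : E, ConeLt P 0 c → ∃ n₀ : ℕ, ∀ n ≥ n₀, ∀ m ≥ n₀, ConeLt P (d (u n) (u m)) c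

/-- Completeness of a cone metric space. -/
def ConeComplete {E M : Type*} [NormedAddCommGroup E] [NormedSpace ℝ E]
    (P : Set E) (d : M → M → E) : Prop :=
  ∀ u : ℕ → M, ConeCauchy P d u → ∃ x : M, ConeConv P d u x

/-- Sequential continuity of a self-map of a cone metric space. -/
def ConeSeqContinuous {E M : Type*} [NormedAddCommGroup E] [NormedSpace ℝ E]
    (P : Set E) (d : M → M → E) (T : M → M) : Prop :=
  ∀ (u : ℕ → M) (x : M), ConeConv P d u x → ConeConv P d (fun n => T (u n)) (T x)

/-- `(S, T)` is a pair of generalized Zamfirescu operators with constants `a`, `b`, `c`. -/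
def IsGZO {E M : Type*} [NormedAddCommGroup E] [NormedSpace ℝ E]
    (P : Set E) (d : M → M → E) (S T : M → M) (a b c : ℝ) : Prop :=
  0 ≤ a ∧ a < 1 ∧ 0 ≤ b ∧ b < 1/2 ∧ 0 ≤ c ∧ c < 1/2 ∧
    ∀ x y : M,
      ConeLe P (d (S x) (S y)) (a • d (T x) (T y)) ∨
      ConeLe P (d (S x) (S y)) (b • (d (S x) (T x) + d (S y) (T y))) ∨
      ConeLe P (d (S x) (S y)) (c • (d (S x) (T y) + d (S y) (T x)))

/-- `(S, T)` is a generalized weak contraction. -/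
def IsGWC {E M : Type*} [NormedAddCommGroup E] [NormedSpace ℝ E]
    (P : Set E) (d : M → M → E) (S T : M → M) : Prop :=
  ∃ δ L : ℝ, 0 < δ ∧ δ < 1 ∧ 0 ≤ L ∧
    ∀ x y : M, ConeLe P (d (S x) (S y)) (δ • d (T x) (T y) + L • d (S x) (T x))

open Filter Topology
open scoped Pointwise

section Cone

variable {E M : Type*} [NormedAddCommGroup E] [NormedSpace ℝ E] {P : Set E}

theorem IsCone.add_mem (hP : IsCone P) {x y : E} (hx : x ∈ P) (hy : y ∈ P) : x + y ∈ P := by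
  simpa using hP.2.2.2.1 1 1 zero_le_one zero_le_one x hx y hy

theorem IsCone.smul_mem (hP : IsCone P) {t : ℝ} (ht : 0 ≤ t) {x : E} (hx : x ∈ P) :
    t • x ∈ P := by
  simpa using hP.2.2.2.1 t 0 ht le_rfl x hx x hx

theorem IsCone.eq_zero_of_neg_mem (hP : IsCone P) {x : E} (hx : x ∈ P) (hx' : -x ∈ P) :
    x = 0 := by
  have h : x ∈ P ∩ (-P) := ⟨hx, hx'⟩
  rwa [hP.2.2.2.2] at h

theorem IsCone.zero_mem (hP : IsCone P) : (0 : E) ∈ P := by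
  have h : (0 : E) ∈ P ∩ (-P) := by rw [hP.2.2.2.2]; rfl
  exact h.1

theorem IsCone.smul_mem_interior (hP : IsCone P) {t : ℝ} (ht : 0 < t) {x : E}
    (hx : x ∈ interior P) : t • x ∈ interior P := by
  have hsub : t • interior P ⊆ P := by
    rintro _ ⟨y, hy, rfl⟩
    exact hP.smul_mem ht.le (interior_subset hy)
  exact interior_maximal hsub (isOpen_interior.smul₀ ht.ne') (Set.smul_mem_smul_set hx)

/-- An element of the cone with a positive multiple below every term of a null sequence
vanishes. -/
theorem IsCone.eq_zero_of_tendsto (hP : IsCone P) {x : E} (hx : x ∈ P) {t : ℝ} (ht : 0 < t)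
    {e : ℕ → E} (he : Tendsto e atTop (𝓝 0)) (hle : ∀ n, ConeLe P (t • x) (e n)) : x = 0 := by
  have hlim : Tendsto (fun n => e n - t • x) atTop (𝓝 (0 - t • x)) := he.sub_const _
  have hmem : 0 - t • x ∈ P := hP.1.mem_of_tendsto hlim (Eventually.of_forall hle)
  refine hP.eq_zero_of_neg_mem hx ?_
  have h := hP.smul_mem (inv_nonneg.2 ht.le) hmem
  rwa [zero_sub, smul_neg, inv_smul_smul₀ ht.ne'] at h

theorem IsNormalCone.tendsto_zero_of_le {K : ℝ} (hK : IsNormalCone P K) {ι : Type*}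
    {l : Filter ι} {f g : ι → E} (hf : ∀ i, f i ∈ P) (hfg : ∀ i, ConeLe P (f i) (g i))
    (hg : Tendsto g l (𝓝 0)) : Tendsto f l (𝓝 0) := by
  refine squeeze_zero_norm (a := fun i => K * ‖g i‖)
    (fun i => hK.2 _ _ (by simpa [ConeLe] using hf i) (hfg i)) ?_
  simpa using hg.norm.const_mul K

theorem eventually_coneLt {ι : Type*} {l : Filter ι} {f : ι → E} (hf : Tendsto f l (𝓝 0))
    {c : E} (hc : ConeLt P 0 c) : ∀ᶠ i in l, ConeLt P (f i) c := by
  have h : Tendsto (fun i => c - f i) l (𝓝 (c - 0)) := hf.const_sub c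
  exact h.eventually (isOpen_interior.mem_nhds hc)

theorem ConeConv.tendsto_zero {K : ℝ} {d : M → M → E} {u : ℕ → M} {x : M}
    (hP : IsCone P) (hint : (interior P).Nonempty) (hK : IsNormalCone P K)
    (hd : IsConeMetric P d) (h : ConeConv P d u x) :
    Tendsto (fun n => d (u n) x) atTop (𝓝 0) := by
  obtain ⟨c, hc⟩ := hint
  rw [Metric.tendsto_atTop]
  intro ε hε
  have hlim : Tendsto (fun t : ℝ => K * ‖t • c‖) (𝓝[>] 0) (𝓝 0) := by
    have hcont : Continuous fun t : ℝ => K * ‖t • c‖ := by fun_prop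
    simpa using (hcont.tendsto 0).mono_left nhdsWithin_le_nhds
  obtain ⟨t, htε, ht⟩ := ((hlim.eventually (gt_mem_nhds hε)).and self_mem_nhdsWithin).exists
  obtain ⟨N, hN⟩ := h (t • c) (by simpa [ConeLt] using hP.smul_mem_interior ht hc)
  refine ⟨N, fun n hn => ?_⟩
  rw [dist_zero_right]
  exact (hK.2 _ _ (hd.1 _ _) (interior_subset (hN n hn))).trans_lt htε

/-- A sequence `D` in a normal cone with `D (n + 1) ≤ b (D n + D (n + 1))`, where `b < 1 / 2`,
tends to zero. -/
theorem IsNormalCone.tendsto_zero_of_kannan {K : ℝ} (hP : IsCone P) (hK : IsNormalCone P K)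
    {b : ℝ} (hb : 0 ≤ b) (hb1 : b < 1 / 2) {D : ℕ → E} (hD : ∀ n, D n ∈ P)
    (hstep : ∀ n, ConeLe P (D (n + 1)) (b • (D n + D (n + 1)))) :
    Tendsto D atTop (𝓝 0) := by
  have hpos : 0 < 1 - b := by linarith
  have hr : 0 ≤ b / (1 - b) := div_nonneg hb hpos.le
  have hr1 : b / (1 - b) < 1 := by rw [div_lt_one hpos]; linarith
  have hpow : ∀ n, ConeLe P (D n) ((b / (1 - b)) ^ n • D 0) := by
    intro n
    induction n with
    | zero => simpa [ConeLe] using hP.zero_mem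
    | succ n ih =>
      have h := hP.add_mem (hP.smul_mem (inv_nonneg.2 hpos.le) (hstep n)) (hP.smul_mem hr ih)
      unfold ConeLe
      convert h using 1
      match_scalars
      · ring
      · field_simp
        ring
      · field_simp
        ring
  refine hK.tendsto_zero_of_le hD hpow ?_
  simpa using (tendsto_pow_atTop_nhds_zero_of_lt_one hr hr1).smul_const (D 0)

end Cone

/-- Common fixed point theorem for a generalized Kannan contraction pair in a
complete cone metric space. -/
theorem kannan_cone_fixed_point {E M : Type*} [NormedAddCommGroup E] [NormedSpace ℝ E]
    [CompleteSpace E] [Nonempty M]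
    (P : Set E) (K : ℝ) (d : M → M → E)
    (hP : IsCone P) (hint : (interior P).Nonempty) (hK : IsNormalCone P K)
    (hd : IsConeMetric P d) (hcomp : ConeComplete P d)
    (S T : M → M) (b : ℝ)
    (hT : ConeSeqContinuous P d T)
    (hrange : Set.range S ⊆ Set.range T)
    (hcomm : ∀ x : M, S (T x) = T (S x))
    (hb : 0 ≤ b) (hb1 : b < 1/2)
    (hcontr : ∀ x y : M,
      ConeLe P (d (S x) (S y)) (b • (d (S x) (T x) + d (S y) (T y)))) :
    ∃! z : M, S z = z ∧ T z = z := by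
  obtain ⟨hnn, hzero, hsymm, htri⟩ := id hd
  have hmem : ∀ x y, d x y ∈ P := fun x y => by simpa [ConeLe] using hnn x y
  have coincidence_eq : ∀ x y, S x = T x → S y = T y → S x = S y := by
    intro x y hx hy
    have h := hcontr x y
    rw [(hzero (S x) (T x)).2 hx, (hzero (S y) (T y)).2 hy] at h
    exact (hzero _ _).1 (hP.eq_zero_of_neg_mem (hmem _ _) (by simpa [ConeLe] using h))
  choose g hg using fun x => hrange (Set.mem_range_self x)
  obtain ⟨x₀⟩ := ‹Nonempty M›
  let x : ℕ → M := fun n => g^[n] x₀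
  have hx : ∀ n, T (x (n + 1)) = S (x n) := fun n => by
    simp only [x, Function.iterate_succ_apply', hg]
  have hD : Tendsto (fun n => d (S (x (n + 1))) (S (x n))) atTop (𝓝 0) := by
    refine hK.tendsto_zero_of_kannan hP hb hb1 (fun n => hmem _ _) fun n => ?_
    have h := hcontr (x (n + 2)) (x (n + 1))
    rw [hx, hx] at h
    rwa [add_comm (d (S (x (n + 1))) (S (x n)))]
  have hcauchy : ConeCauchy P d fun n => S (x (n + 1)) := by
    intro c hc
    have hbound : Tendsto (fun p : ℕ × ℕ => b • (d (S (x (p.1 + 1))) (S (x p.1)) +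
        d (S (x (p.2 + 1))) (S (x p.2)))) (atTop ×ˢ atTop) (𝓝 0) := by
      simpa using ((hD.comp tendsto_fst).add (hD.comp tendsto_snd)).const_smul b
    have hlim := hK.tendsto_zero_of_le
      (f := fun p : ℕ × ℕ => d (S (x (p.1 + 1))) (S (x (p.2 + 1)))) (fun p => hmem _ _)
      (fun p => by simpa only [hx] using hcontr (x (p.1 + 1)) (x (p.2 + 1))) hbound
    have hev := eventually_coneLt hlim hc
    rw [prod_atTop_atTop_eq, eventually_atTop] at hev
    obtain ⟨⟨N₁, N₂⟩, hN⟩ := hev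
    exact ⟨max N₁ N₂, fun n hn m hm =>
      hN (n, m) ⟨(le_max_left _ _).trans hn, (le_max_right _ _).trans hm⟩⟩
  obtain ⟨z, hz⟩ := hcomp _ hcauchy
  have hTz := (hT _ _ hz).tendsto_zero hP hint hK hd
  have hTz' := hTz.comp (tendsto_add_atTop_nat 1)
  have hST : S z = T z := by
    refine ((hzero _ _).1 (hP.eq_zero_of_tendsto (hmem (T z) (S z)) (t := 1 - b)
      (by linarith) (e := fun n => (1 + b) • d (T (S (x (n + 2)))) (T z) +
        b • d (T (S (x (n + 1)))) (T z)) ?_ fun n => ?_)).symm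
    · simpa using (hTz'.const_smul (1 + b)).add (hTz.const_smul b)
    · have hc := hcontr (S (x (n + 1))) z
      have hS : S (S (x (n + 1))) = T (S (x (n + 2))) := by rw [← hx (n + 1), hcomm]
      rw [hS] at hc
      have h₁ := htri (T z) (S z) (T (S (x (n + 2))))
      have h₂ := htri (T (S (x (n + 2)))) (T (S (x (n + 1)))) (T z)
      rw [hsymm (T z) (T (S (x (n + 2))))] at h₁
      rw [hsymm (T z) (T (S (x (n + 1))))] at h₂
      rw [hsymm (S z) (T z)] at hc
      have h := hP.add_mem (hP.add_mem h₁ hc) (hP.smul_mem hb h₂)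
      unfold ConeLe
      convert h using 1
      module
  have hSS : S (S z) = T (S z) := by rw [← hcomm, hST]
  have hfix : S (S z) = S z := coincidence_eq _ _ hSS hST
  refine ⟨S z, ⟨hfix, hSS.symm.trans hfix⟩, ?_⟩
  rintro w ⟨hSw, hTw⟩
  rw [← hSw]
  exact coincidence_eq _ _ (hSw.trans hTw.symm) hST
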